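/- Let Γ be an n-vertex connected nonregular finite simple graph whose adjacency matrix has exactly three distinct eigenvalues s > 1 > −t with t ≥ 2, which is not a cone and not biregular. Then (1/2)·(t − 1/2)² < n < t² + 8t + 18 + 18/(t − 1). -/

import Mathlib

open Matrix in
/-- A symmetric real matrix whose eigenvalues lie in `{a, b, c}` is annihilated by
`(X - a) (X - b) (X - c)`. -/
theorem Matrix.IsHermitian.cubic_eq_zero {V : Type*} [Fintype V] [DecidableEq V]
    {A : Matrix V V ℝ} (hA : A.IsHermitian) {a b c : ℝ} (h : spectrum ℝ A ⊆ {a, b, c}) :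
    (A - a • 1) * ((A - b • 1) * (A - c • 1)) = 0 := by
  have key : ((A - a • 1) * ((A - b • 1) * (A - c • 1))) * hA.eigenvectorUnitary.1 = 0 := by
    ext i j
    have hv := hA.mulVec_eigenvectorBasis j
    have hmem := h (hA.eigenvalues_mem_spectrum_real j)
    set l := hA.eigenvalues j
    have h2 : ((A - a • 1) * ((A - b • 1) * (A - c • 1))) *ᵥ ⇑(hA.eigenvectorBasis j)
        = ((l - a) * ((l - b) * (l - c))) • ⇑(hA.eigenvectorBasis j) := by
      have h1 (x : ℝ) : (A - x • 1) *ᵥ ⇑(hA.eigenvectorBasis j)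
          = (l - x) • ⇑(hA.eigenvectorBasis j) := by
        rw [sub_mulVec, hv, smul_mulVec, one_mulVec, sub_smul]
      rw [← mulVec_mulVec, ← mulVec_mulVec, h1, mulVec_smul, h1, mulVec_smul, mulVec_smul, h1]
      module
    have h3 : (l - a) * ((l - b) * (l - c)) = 0 := by
      rcases hmem with h | h | h <;> simp_all
    rw [h3, zero_smul] at h2
    exact congrFun h2 i
  have hu : hA.eigenvectorUnitary.1 * star hA.eigenvectorUnitary.1 = 1 :=
    Unitary.mul_star_self_of_mem hA.eigenvectorUnitary.2
  simpa [mul_assoc, hu] using congrArg (· * star hA.eigenvectorUnitary.1) key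

/-- An idempotent matrix has trace equal to its rank. -/
theorem Matrix.trace_eq_rank_of_isIdempotentElem {V : Type*} [Fintype V] [DecidableEq V]
    {P : Matrix V V ℝ} (hP : IsIdempotentElem P) : P.trace = P.rank := by
  have h : IsIdempotentElem (Matrix.toLin' P) := by
    unfold IsIdempotentElem
    rw [Module.End.mul_eq_comp, ← Matrix.toLin'_mul, hP.eq]
  have := (LinearMap.IsIdempotentElem.isProj_range _ h).trace
  rwa [Matrix.trace_toLin'_eq] at this

open Matrix in
/-- The Hadamard square of a matrix of rank `k` has rank at most `(k + 1).choose 2`. -/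
theorem Matrix.rank_hadamard_self_le {V : Type*} [Fintype V] [DecidableEq V] (S : Matrix V V ℝ) :
    (S ⊙ S).rank ≤ (S.rank + 1).choose 2 := by
  let U := LinearMap.range S.mulVecLin
  let b := Module.finBasis ℝ U
  let f : Sym2 (Fin (Module.finrank ℝ U)) → (V → ℝ) :=
    Sym2.lift ⟨fun i j => (b i : V → ℝ) * (b j : V → ℝ), fun i j => mul_comm _ _⟩
  have hcol (v : V) : (S ⊙ S).col v ∈ Submodule.span ℝ (Set.range f) := by
    have hv : S.col v ∈ U := ⟨Pi.single v 1, by simp⟩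
    have hsum : S.col v = ∑ i, b.repr ⟨_, hv⟩ i • (b i : V → ℝ) := by
      have := congrArg Subtype.val (b.sum_repr ⟨_, hv⟩)
      rw [AddSubmonoidClass.coe_finsetSum] at this
      exact this.symm
    have : (S ⊙ S).col v = S.col v * S.col v := by ext; simp
    rw [this, hsum, Finset.sum_mul_sum]
    refine Submodule.sum_mem _ fun i _ => Submodule.sum_mem _ fun j _ => ?_
    rw [smul_mul_smul_comm]
    exact Submodule.smul_mem _ _ (Submodule.subset_span ⟨s(i, j), rfl⟩)
  rw [Matrix.rank_eq_finrank_span_cols]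
  calc _ ≤ Module.finrank ℝ (Submodule.span ℝ (Set.range f)) :=
        Submodule.finrank_mono (Submodule.span_le.2 (by rintro _ ⟨v, rfl⟩; exact hcol v))
    _ ≤ Fintype.card (Sym2 (Fin (Module.finrank ℝ U))) := finrank_range_le_card f
    _ = _ := by rw [Sym2.card, Fintype.card_fin]; rfl

open Matrix Pointwise in
/-- A symmetric matrix is bounded above by the largest element of its spectrum. -/
theorem Matrix.IsHermitian.posSemidef_smul_one_sub {V : Type*} [Fintype V] [DecidableEq V]
    {A : Matrix V V ℝ} (hA : A.IsHermitian) {s : ℝ} (h : ∀ l ∈ spectrum ℝ A, l ≤ s) :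
    (s • (1 : Matrix V V ℝ) - A).PosSemidef := by
  rw [Matrix.posSemidef_iff_isHermitian_and_spectrum_nonneg]
  refine ⟨(isHermitian_one.smul (by simp [IsSelfAdjoint])).sub hA, ?_⟩
  intro l hl
  have : spectrum ℝ (s • (1 : Matrix V V ℝ) - A) = ({s} : Set ℝ) - spectrum ℝ A := by
    rw [spectrum.singleton_sub_eq, Algebra.algebraMap_eq_smul_one]
  rw [this] at hl
  obtain ⟨_, rfl, x, hx, rfl⟩ := hl
  simpa using h x hx

theorem Matrix.rank_add_le {V : Type*} [Fintype V] (M N : Matrix V V ℝ) :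
    (M + N).rank ≤ M.rank + N.rank := by
  unfold Matrix.rank
  rw [Matrix.mulVecLin_add]
  exact (Submodule.finrank_mono (LinearMap.range_add_le _ _)).trans
    (Submodule.finrank_add_le_finrank_add_finrank _ _)

theorem Matrix.rank_smul_le {V : Type*} [Fintype V] (c : ℝ) (M : Matrix V V ℝ) :
    (c • M).rank ≤ M.rank := by
  unfold Matrix.rank
  have : (c • M).mulVecLin = c • M.mulVecLin := by ext; simp
  rw [this]
  exact Submodule.finrank_mono (LinearMap.range_smul_le_range _ _)

namespace SimpleGraph

open Matrix Finset

variable {V : Type*} [Fintype V] [DecidableEq V] {Γ : SimpleGraph V} [DecidableRel Γ.Adj]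
  {s : ℝ}

/-- In a connected graph, a nonnegative eigenvector that vanishes somewhere is zero. -/
theorem Connected.eq_zero_of_nonneg_of_eigenvector (hconn : Γ.Connected) {y : V → ℝ}
    (hy : ∀ v, 0 ≤ y v) (hAy : Γ.adjMatrix ℝ *ᵥ y = s • y) {v : V} (hv : y v = 0) : y = 0 := by
  have step (u w : V) (hu : y u = 0) (huw : Γ.Adj u w) : y w = 0 := by
    have h := congrFun hAy u
    rw [adjMatrix_mulVec_apply, Pi.smul_apply, hu, smul_zero,
      sum_eq_zero_iff_of_nonneg fun x _ => hy x] at h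
    exact h w (by simpa using huw)
  ext w
  obtain ⟨p⟩ := hconn.preconnected v w
  induction p with
  | nil => exact hv
  | cons h _ ih => exact ih (step _ _ hv h)

/-- The entrywise absolute value of an eigenvector for the largest eigenvalue of a graph is again
an eigenvector. -/
theorem adjMatrix_mulVec_abs (hpsd : (s • (1 : Matrix V V ℝ) - Γ.adjMatrix ℝ).PosSemidef)
    {x : V → ℝ} (hx : Γ.adjMatrix ℝ *ᵥ x = s • x) : Γ.adjMatrix ℝ *ᵥ |x| = s • |x| := by
  have h0 : |x| ⬝ᵥ ((s • (1 : Matrix V V ℝ) - Γ.adjMatrix ℝ) *ᵥ |x|) = 0 := by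
    refine le_antisymm ?_ (by simpa using hpsd.dotProduct_mulVec_nonneg |x|)
    have h1 : x ⬝ᵥ (Γ.adjMatrix ℝ *ᵥ x) ≤ |x| ⬝ᵥ (Γ.adjMatrix ℝ *ᵥ |x|) := by
      simp only [dotProduct, adjMatrix_mulVec_apply, Pi.abs_apply, mul_sum]
      refine sum_le_sum fun u _ => sum_le_sum fun w _ => ?_
      rw [← abs_mul]
      exact le_abs_self _
    have h2 : |x| ⬝ᵥ |x| = x ⬝ᵥ x := by simp [dotProduct]
    rw [hx, dotProduct_smul] at h1
    rw [sub_mulVec, smul_mulVec, one_mulVec, dotProduct_sub, dotProduct_smul, h2]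
    linarith
  have h3 := (hpsd.dotProduct_mulVec_zero_iff |x|).1 (by simpa using h0)
  rw [sub_mulVec, smul_mulVec, one_mulVec, sub_eq_zero] at h3
  exact h3.symm

/-- Perron–Frobenius for the adjacency matrix of a connected graph: the largest eigenvalue has a
positive eigenvector, which spans the eigenspace. -/
theorem Connected.exists_perron (hconn : Γ.Connected)
    (hpsd : (s • (1 : Matrix V V ℝ) - Γ.adjMatrix ℝ).PosSemidef)
    (hs : s ∈ spectrum ℝ (Γ.adjMatrix ℝ)) :
    ∃ β : V → ℝ, (∀ v, 0 < β v) ∧ Γ.adjMatrix ℝ *ᵥ β = s • β ∧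
      ∀ z, Γ.adjMatrix ℝ *ᵥ z = s • z → ∃ c : ℝ, z = c • β := by
  obtain ⟨x, hx0, hx⟩ : ∃ x : V → ℝ, x ≠ 0 ∧ Γ.adjMatrix ℝ *ᵥ x = s • x := by
    rw [← Matrix.spectrum_toLin', ← Module.End.hasEigenvalue_iff_mem_spectrum] at hs
    obtain ⟨x, hx⟩ := hs.exists_hasEigenvector
    exact ⟨x, hx.2, by simpa using hx.apply_eq_smul⟩
  have hpos (v : V) : 0 < |x| v := by
    refine (abs_nonneg (x v)).lt_of_ne' fun h => hx0 ?_
    exact funext fun w => abs_eq_zero.1 (congrFun (hconn.eq_zero_of_nonneg_of_eigenvector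
      (fun _ => abs_nonneg _) (adjMatrix_mulVec_abs hpsd hx) h) w)
  have hA := adjMatrix_mulVec_abs hpsd hx
  refine ⟨|x|, hpos, hA, fun z hz => ?_⟩
  obtain ⟨v⟩ := hconn.nonempty
  refine ⟨z v / |x| v, ?_⟩
  have hu : Γ.adjMatrix ℝ *ᵥ (z - (z v / |x| v) • |x|) = s • (z - (z v / |x| v) • |x|) := by
    rw [mulVec_sub, mulVec_smul, hA, hz]
    module
  have h0 := hconn.eq_zero_of_nonneg_of_eigenvector (v := v) (fun _ => abs_nonneg _)
    (adjMatrix_mulVec_abs hpsd hu) (by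
      have := (hpos v).ne'
      simp only [Pi.abs_apply, Pi.sub_apply, Pi.smul_apply, smul_eq_mul] at this ⊢
      rw [div_mul_cancel₀ _ this, sub_self, abs_zero])
  exact sub_eq_zero.1 (funext fun w => abs_eq_zero.1 (congrFun h0 w))

/-- A positive eigenvector `α` of eigenvalue `s` with `(A - 1) (A + t) = α αᵀ`, where `A` is the
adjacency matrix. -/
structure IsPerronWeight (Γ : SimpleGraph V) [DecidableRel Γ.Adj] (s t : ℝ) (α : V → ℝ) : Prop where
  pos : ∀ v, 0 < α v
  mulVec_eq : Γ.adjMatrix ℝ *ᵥ α = s • α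
  mul_eq : (Γ.adjMatrix ℝ - 1) * (Γ.adjMatrix ℝ + t • 1) = vecMulVec α α

/-- A connected graph whose distinct adjacency eigenvalues are `s > 1 > -t` has a Perron weight. -/
theorem Connected.exists_isPerronWeight (hconn : Γ.Connected) {t : ℝ} (hs : 1 < s) (ht : -t < 1)
    (hspec : spectrum ℝ (Γ.adjMatrix ℝ) = {s, 1, -t}) :
    ∃ α : V → ℝ, IsPerronWeight Γ s t α := by
  have hH : (Γ.adjMatrix ℝ).IsHermitian := by
    simp [IsHermitian, conjTranspose_eq_transpose_of_trivial]
  have hpsd := hH.posSemidef_smul_one_sub (s := s) (by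
    rw [hspec]; rintro l (rfl | rfl | rfl) <;> linarith)
  obtain ⟨β, hβ, hAβ, hspan⟩ := hconn.exists_perron hpsd (by simp [hspec])
  set A := Γ.adjMatrix ℝ with hAdef
  have hAT : Aᵀ = A := transpose_adjMatrix _
  have hcub := hH.cubic_eq_zero (a := s) (b := 1) (c := -t) hspec.subset
  rw [one_smul, neg_smul, sub_neg_eq_add] at hcub
  set W := (A - 1) * (A + t • 1) with hW
  have hWT : Wᵀ = W := by
    simp only [hW, transpose_mul, transpose_add, transpose_sub, transpose_smul, transpose_one, hAT]
    simp only [mul_add, add_mul, sub_mul, mul_sub, smul_mul_assoc, mul_smul_comm, one_mul, mul_one]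
    module
  have hcol (v : V) : ∃ c : ℝ, W.col v = c • β := by
    apply hspan
    have h' : (A - s • 1) *ᵥ W.col v = 0 := by
      rw [← mulVec_single_one W v, mulVec_mulVec, hcub, zero_mulVec]
    rw [sub_mulVec, smul_mulVec, one_mulVec, sub_eq_zero] at h'
    exact h'
  choose γ hγ using hcol
  have hWe (u v : V) : W u v = γ v * β u := congrFun (hγ v) u
  obtain ⟨o⟩ := hconn.nonempty
  set κ := γ o / β o with hκ
  have hγκ (v : V) : γ v = κ * β v := by
    have h1 : W o v = W v o := congrFun (congrFun hWT v) o
    rw [hWe, hWe] at h1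
    rw [hκ, div_mul_eq_mul_div, ← h1, mul_div_cancel_right₀ _ (hβ o).ne']
  have hκpos : 0 < κ := by
    have h1 : W *ᵥ β = ((s - 1) * (s + t)) • β := by
      rw [hW, ← mulVec_mulVec, add_mulVec, hAβ, smul_mulVec, one_mulVec, ← add_smul, mulVec_smul,
        sub_mulVec, hAβ, one_mulVec]
      module
    have h2 := congrFun h1 o
    simp only [mulVec, dotProduct, hWe, hγκ, Pi.smul_apply, smul_eq_mul] at h2
    have h3 : ∑ v, κ * β v * β o * β v = κ * (β o * ∑ v, β v * β v) := by
      rw [mul_sum, mul_sum]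
      exact sum_congr rfl fun _ _ => by ring
    rw [h3] at h2
    have h4 : 0 < κ * (β o * ∑ v, β v * β v) := by
      rw [h2]
      have := hβ o
      have : 0 < s - 1 := by linarith
      have : 0 < s + t := by linarith
      positivity
    exact pos_of_mul_pos_left h4
      (mul_nonneg (hβ o).le (sum_nonneg fun v _ => mul_self_nonneg _))
  refine ⟨√κ • β, fun v => mul_pos (Real.sqrt_pos.2 hκpos) (hβ v), ?_, ?_⟩
  · rw [mulVec_smul, hAβ, smul_comm]
  · rw [← hAdef, ← hW]
    ext u v
    rw [hWe, hγκ, vecMulVec_apply]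
    simp only [Pi.smul_apply, smul_eq_mul]
    linear_combination (-β u * β v) * Real.mul_self_sqrt hκpos.le

namespace IsPerronWeight

variable {t : ℝ} {α : V → ℝ}

theorem mul_self_eq (h : IsPerronWeight Γ s t α) :
    Γ.adjMatrix ℝ * Γ.adjMatrix ℝ =
      vecMulVec α α + (1 - t) • Γ.adjMatrix ℝ + t • (1 : Matrix V V ℝ) := by
  rw [← h.mul_eq]
  simp only [mul_add, sub_mul, mul_smul_comm, one_mul, mul_one]
  module

theorem degree_eq (h : IsPerronWeight Γ s t α) (v : V) : (Γ.degree v : ℝ) = t + α v ^ 2 := by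
  rw [← adjMatrix_mul_self_apply_self Γ v, h.mul_self_eq]
  simp [vecMulVec_apply]
  ring

theorem _root_.SimpleGraph.adjMatrix_mul_self_apply (Γ : SimpleGraph V) [DecidableRel Γ.Adj]
    (u v : V) : (Γ.adjMatrix ℝ * Γ.adjMatrix ℝ) u v =
      ((Γ.neighborFinset u ∩ Γ.neighborFinset v).card : ℝ) := by
  rw [adjMatrix_mul_apply]
  simp only [adjMatrix_apply, sum_boole, adj_comm _ _ v]
  congr 2
  ext
  simp

theorem card_inter_of_adj (h : IsPerronWeight Γ s t α) {u v : V} (huv : Γ.Adj u v) :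
    ((Γ.neighborFinset u ∩ Γ.neighborFinset v).card : ℝ) = α u * α v + 1 - t := by
  rw [← adjMatrix_mul_self_apply, h.mul_self_eq]
  simp [vecMulVec_apply, huv, huv.ne]
  ring

theorem card_inter_of_not_adj (h : IsPerronWeight Γ s t α) {u v : V} (hne : u ≠ v)
    (huv : ¬ Γ.Adj u v) :
    ((Γ.neighborFinset u ∩ Γ.neighborFinset v).card : ℝ) = α u * α v := by
  rw [← adjMatrix_mul_self_apply, h.mul_self_eq]
  simp [vecMulVec_apply, huv, hne]

theorem sum_sq (h : IsPerronWeight Γ s t α) [Nonempty V] :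
    ∑ v, α v ^ 2 = (s - 1) * (s + t) := by
  have h1 : ((Γ.adjMatrix ℝ - 1) * (Γ.adjMatrix ℝ + t • 1)) *ᵥ α = ((s - 1) * (s + t)) • α := by
    rw [← mulVec_mulVec, add_mulVec, h.mulVec_eq, smul_mulVec, one_mulVec, ← add_smul, mulVec_smul,
      sub_mulVec, h.mulVec_eq, one_mulVec]
    module
  rw [h.mul_eq, vecMulVec_mulVec] at h1
  obtain ⟨o⟩ := ‹Nonempty V›
  have h2 := congrFun h1 o
  simp only [Pi.smul_apply, dotProduct, smul_eq_mul, MulOpposite.smul_eq_mul_unop,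
    MulOpposite.unop_op] at h2
  rw [mul_comm] at h2
  simpa [sq] using mul_right_cancel₀ (h.pos o).ne' h2

/-- The adjacency matrix is annihilated by `(X - 1) (X - s) (X + t)`. -/
theorem cubic_eq_zero (h : IsPerronWeight Γ s t α) :
    (Γ.adjMatrix ℝ - 1) * (Γ.adjMatrix ℝ - s • 1) * (Γ.adjMatrix ℝ + t • 1) = 0 := by
  have h1 : (Γ.adjMatrix ℝ - s • 1) * vecMulVec α α = 0 := by
    rw [mul_vecMulVec, sub_mulVec, h.mulVec_eq, smul_mulVec, one_mulVec, sub_self]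
    ext; simp [vecMulVec_apply]
  rw [← h1, ← h.mul_eq]
  simp only [mul_add, sub_mul, mul_sub, smul_mul_assoc, mul_smul_comm, one_mul, mul_one]
  simp only [mul_assoc]
  module

/-- The spectral projection onto the eigenspace of `-t`. -/
noncomputable def _root_.SimpleGraph.negProj (Γ : SimpleGraph V) [DecidableRel Γ.Adj] (s t : ℝ) :
    Matrix V V ℝ :=
  ((t + 1) * (s + t))⁻¹ • ((Γ.adjMatrix ℝ - 1) * (Γ.adjMatrix ℝ - s • 1))

theorem smul_negProj (ht : 0 < t + 1) (hst : 0 < s + t) :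
    ((t + 1) * (s + t)) • Γ.negProj s t = (Γ.adjMatrix ℝ - 1) * (Γ.adjMatrix ℝ - s • 1) := by
  rw [negProj, smul_inv_smul₀ (by positivity)]

theorem isIdempotentElem_negProj (h : IsPerronWeight Γ s t α) (ht : 0 < t + 1) (hst : 0 < s + t) :
    IsIdempotentElem (Γ.negProj s t) := by
  set A := Γ.adjMatrix ℝ with hA
  set N := (A - 1) * (A - s • 1) with hN
  have h1 : N * A = -t • N := by
    have := h.cubic_eq_zero
    rw [← hA, ← hN, mul_add, mul_smul_comm, mul_one] at this
    rw [neg_smul]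
    exact eq_neg_of_add_eq_zero_left this
  have h2 : N * N = ((t + 1) * (s + t)) • N := by
    conv_lhs => rw [hN, ← hN, ← mul_assoc]
    simp only [mul_sub, sub_mul, mul_one, h1, mul_smul_comm, smul_mul_assoc]
    module
  unfold IsIdempotentElem negProj
  rw [← hA, ← hN, smul_mul_smul_comm, h2, smul_smul]
  congr 1
  field_simp

theorem trace_negProj (h : IsPerronWeight Γ s t α) [Nonempty V] (ht : 0 < t + 1)
    (hst : 0 < s + t) : (t + 1) * (Γ.negProj s t).trace = Fintype.card V + s - 1 := by
  have h1 := congrArg Matrix.trace (smul_negProj (Γ := Γ) ht hst)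
  simp only [mul_sub, sub_mul, mul_one, one_mul, mul_smul_comm, h.mul_self_eq, trace_sub,
    trace_add, trace_smul, trace_adjMatrix, trace_one, trace_vecMulVec, smul_eq_mul] at h1
  have h2 : α ⬝ᵥ α = (s - 1) * (s + t) := by
    rw [← h.sum_sq]
    simp [dotProduct, sq]
  rw [h2] at h1
  apply mul_left_cancel₀ hst.ne'
  linear_combination h1

/-- The multiplicity of `-t` is determined by the trace of the adjacency matrix. -/
theorem rank_negProj (h : IsPerronWeight Γ s t α) [Nonempty V] (ht : 0 < t + 1)
    (hst : 0 < s + t) : ((Γ.negProj s t).rank : ℝ) * (t + 1) = Fintype.card V + s - 1 := by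
  rw [← trace_eq_rank_of_isIdempotentElem (h.isIdempotentElem_negProj ht hst),
    ← h.trace_negProj ht hst, mul_comm]

theorem sub_one_eq (h : IsPerronWeight Γ s t α) (ht : 0 < t + 1) (hst : 0 < s + t) :
    Γ.adjMatrix ℝ - 1 = (s + t)⁻¹ • vecMulVec α α - (t + 1) • Γ.negProj s t := by
  have h1 : (s + t) • (Γ.adjMatrix ℝ - 1) =
      vecMulVec α α - ((t + 1) * (s + t)) • Γ.negProj s t := by
    rw [smul_negProj ht hst, ← h.mul_eq]
    simp only [mul_add, mul_sub, mul_smul_comm, mul_one]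
    module
  rw [← inv_smul_smul₀ hst.ne' (Γ.adjMatrix ℝ - 1), h1, smul_sub, smul_smul]
  congr 2
  field_simp

/-- The absolute bound. -/
theorem card_le_choose (h : IsPerronWeight Γ s t α) (ht : 0 < t + 1) (hst : 0 < s + t)
    (hneg : -1 ∉ spectrum ℝ (Γ.adjMatrix ℝ)) :
    Fintype.card V ≤ ((Γ.negProj s t).rank + 2).choose 2 := by
  have h1 : (Γ.adjMatrix ℝ - 1) ⊙ (Γ.adjMatrix ℝ - 1) = Γ.adjMatrix ℝ + 1 := by
    ext u v
    by_cases huv : u = v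
    · simp [huv]
    · by_cases hadj : Γ.Adj u v <;> simp [huv, hadj]
  have h2 : IsUnit (Γ.adjMatrix ℝ + 1) := by
    have := spectrum.notMem_iff.1 hneg
    rw [map_neg, map_one, ← IsUnit.neg_iff] at this
    convert this using 1
    abel
  have h3 : (Γ.adjMatrix ℝ - 1).rank ≤ (Γ.negProj s t).rank + 1 := by
    rw [h.sub_one_eq ht hst, sub_eq_add_neg, ← neg_smul, ← smul_vecMulVec, add_comm]
    exact (rank_add_le _ _).trans (add_le_add (rank_smul_le _ _) (rank_vecMulVec_le _ _))
  calc Fintype.card V = (Γ.adjMatrix ℝ + 1).rank := (rank_of_isUnit _ h2).symm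
    _ ≤ ((Γ.adjMatrix ℝ - 1).rank + 1).choose 2 := h1 ▸ rank_hadamard_self_le _
    _ ≤ _ := Nat.choose_le_choose 2 (by omega)

/-- Cocliques have at most as many vertices as the multiplicity of `-t`. -/
theorem card_le_rank_of_coclique (h : IsPerronWeight Γ s t α) (ht : 0 < t + 1) (hst : 0 < s + t)
    {C : Finset V} (hC : ∀ u ∈ C, ∀ v ∈ C, ¬ Γ.Adj u v) : C.card ≤ (Γ.negProj s t).rank := by
  let e : (C → ℝ) →ₗ[ℝ] (V → ℝ) := Function.ExtendByZero.linearMap ℝ (Subtype.val : C → V)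
  have he (f : C → ℝ) (v : V) (hv : v ∉ C) : e f v = 0 :=
    Function.extend_apply' _ _ _ (by rintro ⟨x, rfl⟩; exact hv x.2)
  have hinj : Function.Injective ((Γ.negProj s t).mulVecLin ∘ₗ e) := by
    rw [injective_iff_map_eq_zero]
    intro f hf
    have hf' : Γ.negProj s t *ᵥ e f = 0 := hf
    have h1 : e f ⬝ᵥ ((Γ.adjMatrix ℝ - 1) *ᵥ e f) = (s + t)⁻¹ * (α ⬝ᵥ e f) ^ 2 := by
      rw [h.sub_one_eq ht hst, sub_mulVec, smul_mulVec, smul_mulVec, hf', smul_zero, sub_zero,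
        vecMulVec_mulVec, dotProduct_smul, dotProduct_smul, dotProduct_comm (e f) α]
      simp [sq]
    have h2 : e f ⬝ᵥ (Γ.adjMatrix ℝ *ᵥ e f) = 0 := by
      simp only [dotProduct, adjMatrix_mulVec_apply, mul_sum]
      refine sum_eq_zero fun u _ => sum_eq_zero fun v hv => ?_
      by_cases hu : u ∈ C
      · have : v ∉ C := fun hvC => hC u hu v hvC (by simpa using hv)
        rw [he f v this, mul_zero]
      · rw [he f u hu, zero_mul]
    rw [sub_mulVec, one_mulVec, dotProduct_sub, h2] at h1
    have h3 : 0 ≤ (s + t)⁻¹ * (α ⬝ᵥ e f) ^ 2 := by positivity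
    have h4 : e f = 0 := by
      rw [← dotProduct_self_eq_zero]
      exact le_antisymm (by linarith) (dotProduct_self_star_nonneg (e f))
    ext x
    have := congrFun h4 x
    rwa [show e f x = f x from Subtype.val_injective.extend_apply _ _ _] at this
  calc C.card = Module.finrank ℝ (C → ℝ) := by simp
    _ = Module.finrank ℝ (LinearMap.range ((Γ.negProj s t).mulVecLin ∘ₗ e)) :=
        (LinearMap.finrank_range_of_inj hinj).symm
    _ ≤ _ := Submodule.finrank_mono (LinearMap.range_comp_le_range _ _)

/-- If `-t` is not a simple eigenvalue then `t` is an integer. -/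
theorem exists_int_eq (h : IsPerronWeight Γ s t α) [Nonempty V] (hs : 1 < s) (ht : 0 < t + 1)
    (hst : 0 < s + t) (hmem : -t ∈ spectrum ℝ (Γ.adjMatrix ℝ))
    (hm : (Γ.negProj s t).rank ≠ 1) : ∃ k : ℤ, t = k := by
  have hrank := h.rank_negProj ht hst
  set m := (Γ.negProj s t).rank
  set n := Fintype.card V with hn
  have hn1 : (1 : ℝ) ≤ n := by exact_mod_cast Fintype.card_pos
  have hm0 : (m : ℝ) ≠ 0 := by
    intro h0
    rw [h0] at hrank
    linarith
  obtain ⟨E, hE⟩ : ∃ E : ℤ, (Γ.adjMatrix ℝ * Γ.adjMatrix ℝ).trace = E := by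
    refine ⟨∑ v, Γ.degree v, ?_⟩
    push_cast
    exact sum_congr rfl fun v _ => adjMatrix_mul_self_apply_self Γ v
  obtain ⟨T, hT⟩ : ∃ T : ℤ,
      (Γ.adjMatrix ℝ * (Γ.adjMatrix ℝ * Γ.adjMatrix ℝ)).trace = T := by
    refine ⟨∑ v, (Fintype.card {p : Γ.Walk v v | p.length = 3} : ℤ), ?_⟩
    push_cast
    refine sum_congr rfl fun v _ => ?_
    rw [diag_apply, ← adjMatrix_pow_apply_eq_card_walk, pow_succ', sq]
  have hE' : (E : ℝ) = n * t + (s - 1) * (s + t) := by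
    rw [← hE, h.mul_self_eq, ← h.sum_sq]
    simp [dotProduct, sq]
    ring
  have hT' : (T : ℝ) = (s - t + 1) * E - s * t * n := by
    have h1 := congrArg Matrix.trace h.cubic_eq_zero
    simp only [mul_add, sub_mul, mul_sub, smul_mul_assoc, mul_smul_comm, one_mul, mul_one, mul_assoc,
      trace_add, trace_sub, trace_smul, hE, hT, trace_adjMatrix, trace_one, smul_eq_mul,
      trace_zero, smul_smul, smul_sub] at h1
    linear_combination h1
  set c : ℤ := m + 1 - n with hc
  have hcR : (c : ℝ) = m + 1 - n := by rw [hc]; push_cast; ring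
  have hsc : s = m * t + c := by rw [hcR]; linarith
  have hnc : (n : ℝ) = m + 1 - c := by rw [hcR]; ring
  have hlead : ((m + 1) * E + n * c : ℝ) = m * (s + t) ^ 2 := by
    rw [hE', hnc, hsc]; ring
  have hlin : t * ((m - 1) * ((m + 1) * E + n * c)) =
      (m + 1) * T - (m + 1) * (c + 1) * E + n * E - n * c * (c - 1) := by
    rw [hT', hE', hnc, hsc]; ring
  have hne : ((m - 1) * ((m + 1) * E + n * c) : ℝ) ≠ 0 := by
    rw [hlead]
    have : (m : ℝ) - 1 ≠ 0 := sub_ne_zero.2 (by exact_mod_cast hm)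
    positivity
  obtain ⟨q, hq⟩ : ∃ q : ℚ, (q : ℝ) = t := by
    refine ⟨((m + 1) * T - (m + 1) * (c + 1) * E + n * E - n * c * (c - 1)) /
      ((m - 1) * ((m + 1) * E + n * c)), ?_⟩
    push_cast
    rw [div_eq_iff hne, hlin]
  have hint : IsIntegral ℤ (-t) := by
    rw [mem_spectrum_iff_isRoot_charpoly] at hmem
    have hmap : (Γ.adjMatrix ℤ).map (Int.castRingHom ℝ) = Γ.adjMatrix ℝ := by
      ext u v
      by_cases huv : Γ.Adj u v <;> simp [huv]
    rw [← hmap, charpoly_map] at hmem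
    exact ⟨_, charpoly_monic _, by rw [← Polynomial.eval_map]; exact hmem⟩
  have hint' : IsIntegral ℤ q := by
    have : IsIntegral ℤ (algebraMap ℚ ℝ q) := by
      rw [eq_ratCast, hq]
      simpa using hint.neg
    exact (isIntegral_algebraMap_iff (algebraMap ℚ ℝ).injective).1 this
  obtain ⟨k, hk⟩ := IsIntegrallyClosed.isIntegral_iff.1 hint'
  exact ⟨k, by rw [← hq, ← hk]; simp⟩

theorem le_degree (h : IsPerronWeight Γ s t α) {v : V} (hv : ∀ w, α w ≤ α v) :
    s ≤ Γ.degree v := by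
  have h1 := congrFun h.mulVec_eq v
  rw [adjMatrix_mulVec_apply, Pi.smul_apply, smul_eq_mul] at h1
  have h2 : ∑ w ∈ Γ.neighborFinset v, α w ≤ Γ.degree v * α v := by
    rw [← nsmul_eq_mul, ← card_neighborFinset_eq_degree]
    exact sum_le_card_nsmul _ _ _ fun w _ => hv w
  exact le_of_mul_le_mul_right (h1 ▸ h2) (h.pos v)

theorem mul_sub_le_of_adj (h : IsPerronWeight Γ s t α) {u w : V} (huw : Γ.Adj u w) :
    α w * (α u - α w) ≤ 2 * t - 2 := by
  have h1 : (Γ.neighborFinset u ∩ Γ.neighborFinset w).card + 1 ≤ Γ.degree w := by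
    rw [← card_neighborFinset_eq_degree, Nat.succ_le_iff]
    refine card_lt_card ⟨inter_subset_right, fun hsub => ?_⟩
    simpa using hsub ((mem_neighborFinset ..).2 huw.symm)
  have h2 : ((Γ.neighborFinset u ∩ Γ.neighborFinset w).card : ℝ) + 1 ≤ Γ.degree w := by
    exact_mod_cast h1
  rw [h.card_inter_of_adj huw, h.degree_eq] at h2
  linarith

theorem sub_one_le_mul_of_adj (h : IsPerronWeight Γ s t α) {u w : V} (huw : Γ.Adj u w) :
    t - 1 ≤ α u * α w := by
  have h1 := h.card_inter_of_adj huw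
  have h2 : (0 : ℝ) ≤ (Γ.neighborFinset u ∩ Γ.neighborFinset w).card := Nat.cast_nonneg _
  linarith

theorem mul_sub_le_of_not_adj (h : IsPerronWeight Γ s t α) {u w : V} (hne : u ≠ w)
    (huw : ¬ Γ.Adj u w) : α w * (α u - α w) ≤ t := by
  have h1 : (Γ.neighborFinset u ∩ Γ.neighborFinset w).card ≤ Γ.degree w := by
    rw [← card_neighborFinset_eq_degree]
    exact card_le_card inter_subset_right
  have h2 : ((Γ.neighborFinset u ∩ Γ.neighborFinset w).card : ℝ) ≤ Γ.degree w := by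
    exact_mod_cast h1
  rw [h.card_inter_of_not_adj hne huw, h.degree_eq] at h2
  linarith

theorem exists_int_mul_eq (h : IsPerronWeight Γ s t α) (ht : ∃ k : ℤ, t = k) (u v : V) :
    ∃ z : ℤ, α u * α v = z := by
  obtain ⟨k, rfl⟩ := ht
  by_cases huv : u = v
  · refine ⟨Γ.degree v - k, ?_⟩
    push_cast
    rw [h.degree_eq, huv]
    ring
  by_cases hadj : Γ.Adj u v
  · refine ⟨(Γ.neighborFinset u ∩ Γ.neighborFinset v).card - 1 + k, ?_⟩
    push_cast
    rw [h.card_inter_of_adj hadj]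
    ring
  · refine ⟨(Γ.neighborFinset u ∩ Γ.neighborFinset v).card, ?_⟩
    push_cast
    rw [h.card_inter_of_not_adj huv hadj]

theorem one_le_of_pos_intCombination (h : IsPerronWeight Γ s t α) (ht : ∃ k : ℤ, t = k)
    (u v : V) (p q : ℤ) (hpos : 0 < p * α u + q * α v) :
    1 ≤ p * α u + q * α v := by
  obtain ⟨x, hx⟩ := h.exists_int_mul_eq ht u u
  obtain ⟨y, hy⟩ := h.exists_int_mul_eq ht u v
  obtain ⟨z, hz⟩ := h.exists_int_mul_eq ht v v
  have h1 : (p * α u + q * α v) ^ 2 = ((p ^ 2 * x + 2 * p * q * y + q ^ 2 * z : ℤ) : ℝ) := by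
    push_cast
    rw [← hx, ← hy, ← hz]
    ring
  have h2 : (0 : ℝ) < ((p ^ 2 * x + 2 * p * q * y + q ^ 2 * z : ℤ) : ℝ) := by
    rw [← h1]; positivity
  have h3 : (1 : ℝ) ≤ ((p ^ 2 * x + 2 * p * q * y + q ^ 2 * z : ℤ) : ℝ) := by
    exact_mod_cast h2
  rw [← h1] at h3
  nlinarith

theorem one_le (h : IsPerronWeight Γ s t α) (ht : ∃ k : ℤ, t = k) (v : V) : 1 ≤ α v := by
  simpa using h.one_le_of_pos_intCombination ht v v 1 0 (by simpa using h.pos v)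

theorem one_le_sub (h : IsPerronWeight Γ s t α) (ht : ∃ k : ℤ, t = k) {u v : V}
    (huv : α u < α v) : 1 ≤ α v - α u := by
  have := h.one_le_of_pos_intCombination ht v u 1 (-1) (by push_cast; linarith)
  push_cast at this
  linarith

theorem one_le_sub_two_mul (h : IsPerronWeight Γ s t α) (ht : ∃ k : ℤ, t = k) {u v : V}
    (huv : 2 * α u < α v) : 1 ≤ α v - 2 * α u := by
  have := h.one_le_of_pos_intCombination ht v u 1 (-2) (by push_cast; linarith)
  push_cast at this
  linarith

/-- The vertices other than `v` that are not adjacent to `v`. -/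
def _root_.SimpleGraph.nonNeighborFinset (Γ : SimpleGraph V) [DecidableRel Γ.Adj] (v : V) :
    Finset V :=
  {x | x ≠ v ∧ ¬ Γ.Adj v x}

theorem _root_.SimpleGraph.sum_eq_add_sum_neighborFinset_add (Γ : SimpleGraph V)
    [DecidableRel Γ.Adj] (v : V) (f : V → ℝ) :
    ∑ x, f x = f v + ∑ x ∈ Γ.neighborFinset v, f x + ∑ x ∈ Γ.nonNeighborFinset v, f x := by
  have h1 : (univ : Finset V) = insert v (Γ.neighborFinset v) ∪ Γ.nonNeighborFinset v := by
    ext x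
    simp only [nonNeighborFinset, mem_univ, mem_union, mem_insert, mem_neighborFinset, mem_filter,
      true_and, true_iff]
    tauto
  rw [h1, sum_union, sum_insert (by simp)]
  rw [Finset.disjoint_left]
  intro x
  simp only [nonNeighborFinset, mem_insert, mem_neighborFinset, mem_filter, mem_univ, true_and]
  tauto

theorem mul_sum_nonNeighborFinset_le (h : IsPerronWeight Γ s t α) {v : V}
    (hv : ∀ w, α w ≤ α v) :
    α v * ∑ x ∈ Γ.nonNeighborFinset v, α x ≤ (2 * t - 2) * (t + α v ^ 2) := by
  have h1 : ∑ x ∈ Γ.neighborFinset v, (Γ.degree x : ℝ) =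
      α v * ∑ x, α x + (1 - t) * Γ.degree v + t := by
    have h2 := congrFun (congrArg (· *ᵥ (fun _ => (1 : ℝ))) h.mul_self_eq) v
    have h3 : Γ.adjMatrix ℝ *ᵥ (fun _ => (1 : ℝ)) = fun x => (Γ.degree x : ℝ) := by
      ext x
      simp [adjMatrix_mulVec_apply]
    simp only [← mulVec_mulVec, h3, add_mulVec, smul_mulVec, one_mulVec, Pi.add_apply,
      Pi.smul_apply, adjMatrix_mulVec_apply, smul_eq_mul, mul_one] at h2
    rw [h2]
    simp [mulVec, dotProduct, vecMulVec_apply, mul_sum]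
  rw [Γ.sum_eq_add_sum_neighborFinset_add v α] at h1
  have h4 : ∑ x ∈ Γ.neighborFinset v, (Γ.degree x : ℝ) ≤
      ∑ x ∈ Γ.neighborFinset v, (t + α v * α x) := by
    refine sum_le_sum fun x _ => ?_
    rw [h.degree_eq]
    nlinarith [hv x, h.pos x]
  rw [sum_add_distrib, ← mul_sum, sum_const, card_neighborFinset_eq_degree, nsmul_eq_mul,
    h1, h.degree_eq] at h4
  linarith

/-- Nonneighbours of a vertex `v` of maximal weight whose weight is less than half of that of `v`
are pairwise nonadjacent. -/
theorem not_adj_of_two_mul_lt (h : IsPerronWeight Γ s t α) (ht : ∃ k : ℤ, t = k) (ht3 : 3 ≤ t)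
    {v x y : V} (hx : x ∈ Γ.nonNeighborFinset v) (hxv : 2 * α x < α v)
    (hy : y ∈ Γ.nonNeighborFinset v) (hyv : 2 * α y < α v) : ¬ Γ.Adj x y := by
  wlog hxy : α y ≤ α x generalizing x y
  · exact fun hadj => this hy hyv hx hxv (le_of_not_ge hxy) hadj.symm
  intro hadj
  simp only [nonNeighborFinset, mem_filter, mem_univ, true_and] at hx
  have h1 := h.mul_sub_le_of_not_adj hx.1.symm hx.2
  have h2 := h.sub_one_le_mul_of_adj hadj
  have h3 := h.one_le_sub_two_mul ht hxv
  have h4 := h.one_le ht x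
  have h5 : α x * α y ≤ α x * α x := mul_le_mul_of_nonneg_left hxy (h.pos x).le
  have h6 : α x * (α v - 2 * α x) ≤ 1 := by linarith
  nlinarith

/-- The nonneighbours of a vertex `v` of maximal weight split into a coclique and a part whose
vertices have weight at least `c * α v`; both parts have bounded size. -/
theorem exists_card_eq_of_le_mul (h : IsPerronWeight Γ s t α) (ht : ∃ k : ℤ, t = k) (ht3 : 3 ≤ t)
    (hst : 0 < s + t) {v : V} (hv : ∀ w, α w ≤ α v) {c : ℝ}
    (hc : ∀ x ∈ Γ.nonNeighborFinset v, α v ≤ 2 * α x → c * α v ≤ α x) :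
    ∃ a b : ℝ, (Fintype.card V : ℝ) = 1 + t + α v ^ 2 + a + b ∧
      a * (t + 1) ≤ Fintype.card V + t + α v ^ 2 - 1 ∧
      b * (c * α v ^ 2) ≤ (2 * t - 2) * (t + α v ^ 2) := by
  have : Nonempty V := ⟨v⟩
  set S := (Γ.nonNeighborFinset v).filter fun x => 2 * α x < α v
  set L := (Γ.nonNeighborFinset v).filter fun x => ¬ 2 * α x < α v
  refine ⟨S.card, L.card, ?_, ?_, ?_⟩
  · have h1 := Γ.sum_eq_add_sum_neighborFinset_add v fun _ => 1
    simp only [sum_const, nsmul_eq_mul, mul_one, card_univ, card_neighborFinset_eq_degree,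
      h.degree_eq] at h1
    rw [h1, ← card_filter_add_card_filter_not (s := Γ.nonNeighborFinset v) fun x => 2 * α x < α v]
    push_cast
    ring
  · have h1 : S.card ≤ (Γ.negProj s t).rank := by
      refine h.card_le_rank_of_coclique (by linarith) hst fun x hx y hy => ?_
      rw [mem_filter] at hx hy
      exact h.not_adj_of_two_mul_lt ht ht3 hx.1 hx.2 hy.1 hy.2
    have h2 := h.rank_negProj (by linarith) hst
    have h3 := h.le_degree hv
    rw [h.degree_eq] at h3
    calc (S.card : ℝ) * (t + 1) ≤ (Γ.negProj s t).rank * (t + 1) := by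
          gcongr
      _ ≤ _ := by linarith
  · have h1 : (L.card : ℝ) * (c * α v) ≤ ∑ x ∈ Γ.nonNeighborFinset v, α x := by
      rw [← nsmul_eq_mul]
      refine (card_nsmul_le_sum L _ _ fun x hx => ?_).trans
        (sum_le_sum_of_subset_of_nonneg (filter_subset _ _) fun x _ _ => (h.pos x).le)
      rw [mem_filter, not_lt] at hx
      exact hc x hx.1 hx.2
    have h2 := mul_le_mul_of_nonneg_left h1 (h.pos v).le
    have h3 := h.mul_sum_nonNeighborFinset_le hv
    linarith

end IsPerronWeight

theorem quadratic_neg_of_endpoints {p q c l r x : ℝ} (hp : 0 ≤ p) (hlx : l ≤ x) (hxr : x ≤ r)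
    (hl : p * l ^ 2 + q * l + c < 0) (hr : p * r ^ 2 + q * r + c < 0) :
    p * x ^ 2 + q * x + c < 0 := by
  by_contra! hx
  have h1 : 0 < p * (x + l) + q := pos_of_mul_pos_right (a := x - l) (by linarith) (by linarith)
  have h2 : p * (r + x) + q < 0 := by
    by_contra! h2
    nlinarith [mul_nonneg (sub_nonneg.2 hxr) h2]
  nlinarith

namespace IsPerronWeight

variable {t : ℝ} {α : V → ℝ}

theorem card_lt_of_le_add_one (h : IsPerronWeight Γ s t α) (ht : ∃ k : ℤ, t = k) (ht2 : 2 ≤ t)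
    (hst : 0 < s + t) {v : V} (hv : ∀ w, α w ≤ α v) (h3v : 3 ≤ α v) (hvt : α v ≤ t + 1) :
    (Fintype.card V : ℝ) < t ^ 2 + 8 * t + 18 := by
  rcases lt_or_ge t 3 with ht3 | ht3
  · have ht' : t = 2 := by
      obtain ⟨k, rfl⟩ := ht
      have h1 : (2 : ℤ) ≤ k := by exact_mod_cast ht2
      have h2 : k < (3 : ℤ) := by exact_mod_cast ht3
      have h3 : k = 2 := by omega
      simp [h3]
    subst ht'
    have hv3 : α v = 3 := by linarith
    have h1 := h.mul_sum_nonNeighborFinset_le hv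
    have h2 := card_nsmul_le_sum (Γ.nonNeighborFinset v) α 1 fun x _ => h.one_le ht x
    have h3 := Γ.sum_eq_add_sum_neighborFinset_add v fun _ => 1
    simp only [sum_const, nsmul_eq_mul, mul_one, card_univ, card_neighborFinset_eq_degree,
      h.degree_eq] at h2 h3
    rw [hv3] at h1 h3
    rw [h3]
    linarith
  · have hA9 : 9 ≤ α v ^ 2 := by nlinarith
    have hAt : α v ^ 2 ≤ (t + 1) ^ 2 := by gcongr
    rcases le_or_gt (α v ^ 2) (9 / 2 * t) with hA | hA
    · obtain ⟨a, b, hn, ha, hb⟩ := h.exists_card_eq_of_le_mul ht ht3 hst hv (c := 1 / 2)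
        fun x _ hx => by linarith
      generalize α v ^ 2 = A at *
      generalize (Fintype.card V : ℝ) = n at *
      have hb' : b * A ≤ 4 * (t - 1) * (t + A) := by linarith
      have h1 : n * t ≤ (t + 1) * (1 + t + A + b) + t + A - 1 := by
        rw [show a = n - 1 - t - A - b by linarith] at ha
        linarith
      have h2 : (t + 2) * A ^ 2 + A * (-t ^ 3 - 3 * t ^ 2 - 15 * t - 4) + 4 * t * (t ^ 2 - 1)
          < 0 := by
        have ht2' : 3 * t ^ 2 ≤ t ^ 3 := by nlinarith [sq_nonneg t]
        rw [mul_comm A]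
        refine quadratic_neg_of_endpoints (by linarith) hA9 hA (by nlinarith) ?_
        have hr : t * (-(9 / 2) * t ^ 3 + 43 / 4 * t ^ 2 - 27 * t - 22) < 0 :=
          mul_neg_of_pos_of_neg (by linarith) (by nlinarith)
        linarith
      have h3 := mul_le_mul_of_nonneg_left hb' (show 0 ≤ t + 1 by linarith)
      have h4 := mul_le_mul_of_nonneg_right h1 (show 0 ≤ A by linarith)
      have h5 : n * (t * A) < (t ^ 2 + 8 * t + 18) * (t * A) := by linarith
      exact lt_of_mul_lt_mul_right h5 (by positivity)
    · obtain ⟨a, b, hn, ha, hb⟩ := h.exists_card_eq_of_le_mul ht ht3 hst hv (c := 2 / 3)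
        fun x hx hx2 => by
          simp only [nonNeighborFinset, mem_filter, mem_univ, true_and] at hx
          by_contra! hlt
          have h1 := h.mul_sub_le_of_not_adj hx.1.symm hx.2
          nlinarith [h.pos x]
      generalize α v ^ 2 = A at *
      generalize (Fintype.card V : ℝ) = n at *
      have hb' : b * A ≤ 3 * (t - 1) * (t + A) := by linarith
      have h1 : n * t ≤ (t + 1) * (1 + t + A + b) + t + A - 1 := by
        rw [show a = n - 1 - t - A - b by linarith] at ha
        linarith
      have h2 : (t + 2) * A ^ 2 + A * ((t + 1) ^ 2 + 3 * (t ^ 2 - 1) + t - 1 - t ^ 3 - 8 * t ^ 2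
          - 18 * t) + 3 * t * (t ^ 2 - 1) < 0 := by
        have ht2' : 3 * t ^ 2 ≤ t ^ 3 := by nlinarith [sq_nonneg t]
        rw [mul_comm A]
        refine quadratic_neg_of_endpoints (by linarith) hA.le hAt ?_ ?_
        · have hr : t * (-(9 / 2) * t ^ 3 + 21 / 4 * t ^ 2 - 27 * t - 33 / 2) < 0 :=
            mul_neg_of_pos_of_neg (by linarith) (by nlinarith)
          linarith
        · nlinarith [pow_pos (show 0 < t by linarith) 4]
      have h3 := mul_le_mul_of_nonneg_left hb' (show 0 ≤ t + 1 by linarith)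
      have h4 := mul_le_mul_of_nonneg_right h1 (show 0 ≤ A by linarith)
      have h5 : n * (t * A) < (t ^ 2 + 8 * t + 18) * (t * A) := by linarith
      exact lt_of_mul_lt_mul_right h5 (by positivity)

theorem eq_of_not_adj_of_add_one_lt (h : IsPerronWeight Γ s t α) (ht : ∃ k : ℤ, t = k)
    {u x : V} (hu : ∀ w, α w ≤ α u) (hut : t + 1 < α u) (hne : u ≠ x) (hux : ¬ Γ.Adj u x) :
    α x = α u := by
  by_contra hlt
  have h1 := h.mul_sub_le_of_not_adj hne hux
  have h2 := h.one_le_sub ht (lt_of_le_of_ne (hu x) hlt)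
  nlinarith [h.one_le ht x]

theorem card_eq_of_add_one_lt (h : IsPerronWeight Γ s t α) (ht : ∃ k : ℤ, t = k)
    {v w : V} (hv : ∀ w, α w ≤ α v) (hvt : t + 1 < α v) (hw : α w < α v) :
    (Fintype.card V : ℝ) = 3 * t - 1 + α v ^ 2 - α w * (α v - α w) := by
  have key (u x : V) (hu : α u = α v) (hx : α x < α v) : Γ.Adj u x := by
    by_contra hadj
    have hne : u ≠ x := by rintro rfl; exact hx.ne hu
    rw [← hu] at hv hvt hx
    exact hx.ne (h.eq_of_not_adj_of_add_one_lt ht hv hvt hne hadj)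
  have hunion : Γ.neighborFinset v ∪ Γ.neighborFinset w = univ := by
    ext z
    simp only [mem_union, mem_neighborFinset, mem_univ, iff_true]
    by_cases hz : α z = α v
    · exact Or.inr (key z w hz hw).symm
    · exact Or.inl (key v z rfl (lt_of_le_of_ne (hv z) hz))
  have h1 := card_union_add_card_inter (Γ.neighborFinset v) (Γ.neighborFinset w)
  rw [hunion, card_univ, card_neighborFinset_eq_degree, card_neighborFinset_eq_degree] at h1
  have h2 : (Fintype.card V : ℝ) + (Γ.neighborFinset v ∩ Γ.neighborFinset w).card =
      Γ.degree v + Γ.degree w := by exact_mod_cast h1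
  rw [h.card_inter_of_adj (key v w rfl hw), h.degree_eq, h.degree_eq] at h2
  linarith

theorem card_lt_of_add_one_lt (h : IsPerronWeight Γ s t α) (ht : ∃ k : ℤ, t = k) (ht2 : 2 ≤ t)
    (hcone : ∀ u, ∃ x, u ≠ x ∧ ¬ Γ.Adj u x) {v w x : V} (hv : ∀ w, α w ≤ α v)
    (hvt : t + 1 < α v) (hwx : α w < α x) (hxv : α x < α v) :
    (Fintype.card V : ℝ) < t ^ 2 + 8 * t + 18 := by
  have key (u z : V) (hu : α u = α v) (hz : α z < α v) : Γ.Adj u z := by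
    by_contra hadj
    have hne : u ≠ z := by rintro rfl; exact hz.ne hu
    rw [← hu] at hv hvt hz
    exact hz.ne (h.eq_of_not_adj_of_add_one_lt ht hv hvt hne hadj)
  have hwv := hwx.trans hxv
  have hcw := h.card_eq_of_add_one_lt ht hv hvt hwv
  have hadd {y : V} (hy : α y < α v) (hyw : α y ≠ α w) : α w + α y = α v := by
    have hcy := h.card_eq_of_add_one_lt ht hv hvt hy
    refine mul_left_cancel₀ (sub_ne_zero.2 hyw) ?_
    linarith
  have hx := hadd hxv hwx.ne'
  have hgap := h.one_le_sub ht hwx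
  have hw1 := h.one_le ht w
  have hw2 : α w < 2 := by
    by_contra! hw2
    have h1 := h.mul_sub_le_of_adj (key v w rfl hwv)
    nlinarith
  obtain ⟨y, z, hy, hz, hyz⟩ : ∃ y z, α y = α w ∧ α z = α x ∧ ¬ Γ.Adj y z := by
    by_contra! hall
    have hlt {a b : V} (hab : ¬ Γ.Adj a b) (hne : a ≠ b) (ha : α a < α v) : α b < α v :=
      lt_of_le_of_ne (hv b) fun hb => hab (key b a hb ha).symm
    obtain ⟨v', hvv', hv'⟩ := hcone v
    obtain ⟨w', hww', hw'⟩ := hcone w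
    obtain ⟨x', hxx', hx'⟩ := hcone x
    have h1 : α v' = α v := h.eq_of_not_adj_of_add_one_lt ht hv hvt hvv' hv'
    have h2 : α w' = α w := by
      by_contra hne
      have := hadd (hlt hw' hww' hwv) hne
      exact hw' (hall w w' rfl (by linarith))
    have h3 : α x' = α x := by
      by_contra hne
      by_cases hxw : α x' = α w
      · exact hx' (hall x' x hxw rfl).symm
      · have := hadd (hlt hx' hxx' hxv) hxw
        exact hne (by linarith)
    have hsub : ({v, v', x, x'} : Finset V) ⊆ Γ.neighborFinset w ∩ Γ.neighborFinset w' := by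
      intro u hu
      simp only [mem_insert, mem_singleton] at hu
      rw [mem_inter, mem_neighborFinset, mem_neighborFinset]
      rcases hu with rfl | rfl | rfl | rfl
      · exact ⟨(key _ _ rfl hwv).symm, (key _ _ rfl (h2 ▸ hwv)).symm⟩
      · exact ⟨(key _ _ h1 hwv).symm, (key _ _ h1 (h2 ▸ hwv)).symm⟩
      · exact ⟨hall _ _ rfl rfl, hall _ _ h2 rfl⟩
      · exact ⟨hall _ _ rfl h3, hall _ _ h2 h3⟩
    have hcard : ({v, v', x, x'} : Finset V).card = 4 := by
      have hab {a b : V} (hab : α b < α a) : a ≠ b := by rintro rfl; exact hab.false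
      rw [card_insert_of_notMem, card_insert_of_notMem, card_pair hxx']
      · simp only [mem_insert, mem_singleton, not_or]
        exact ⟨hab (by linarith), hab (by linarith)⟩
      · simp only [mem_insert, mem_singleton, not_or]
        exact ⟨hvv', hab (by linarith), hab (by linarith)⟩
    have h4 : (4 : ℝ) ≤ (Γ.neighborFinset w ∩ Γ.neighborFinset w').card := by
      exact_mod_cast hcard ▸ card_le_card hsub
    rw [h.card_inter_of_not_adj hww' hw', h2] at h4
    nlinarith
  have hzy : z ≠ y := by
    rintro rfl
    linarith
  have h1 := h.mul_sub_le_of_not_adj hzy fun hadj => hyz hadj.symm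
  rw [hy, hz] at h1
  rw [hcw, ← hx]
  have h2 : α x ≤ t + 1 := by nlinarith
  nlinarith

end IsPerronWeight

end SimpleGraph

theorem H'_st_n_bounds
    {V : Type} [Fintype V] [DecidableEq V] (Γ : SimpleGraph V) [DecidableRel Γ.Adj]
    (s t : ℝ)
    (hconn : Γ.Connected)
    (hnonreg : ¬ ∃ k, Γ.IsRegularOfDegree k)
    (hs : 1 < s) (ht : -t < 1) (ht2 : 2 ≤ t)
    (hspec : spectrum ℝ (Γ.adjMatrix ℝ) = {s, 1, -t})
    (hnotcone : ¬ ∃ v : V, Γ.degree v = Fintype.card V - 1)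
    (hnotbireg : ((Finset.univ : Finset V).image (fun v => Γ.degree v)).card ≠ 2) :
    (1 / 2 : ℝ) * (t - 1 / 2) ^ 2 < (Fintype.card V : ℝ) ∧
    (Fintype.card V : ℝ) < t ^ 2 + 8 * t + 18 + 18 / (t - 1) := by
  obtain ⟨α, h⟩ := hconn.exists_isPerronWeight hs ht hspec
  have hne : Nonempty V := hconn.nonempty
  have ht1 : 0 < t + 1 := by linarith
  have hst : 0 < s + t := by linarith
  obtain ⟨v, hv⟩ : ∃ v, ∀ w, α w ≤ α v := Finite.exists_max α
  have hrank := h.rank_negProj ht1 hst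
  have hchoose := h.card_le_choose ht1 hst (by
    rw [hspec]
    rintro (h1 | h1 | h1)
    · linarith
    · linarith
    · linarith [Set.mem_singleton_iff.1 h1])
  have hdeg (u : V) : Γ.degree u + 2 ≤ Fintype.card V := by
    have h1 := Γ.degree_lt_card_verts u
    have h2 : Γ.degree u ≠ Fintype.card V - 1 := fun h2 => hnotcone ⟨u, h2⟩
    omega
  have hsn : s + 2 ≤ Fintype.card V :=
    calc s + 2 ≤ Γ.degree v + 2 := by linarith [h.le_degree hv]
      _ ≤ _ := by exact_mod_cast hdeg v
  set m := (Γ.negProj s t).rank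
  constructor
  · have h1 : 2 * (Fintype.card V : ℝ) ≤ (m + 2) * (m + 1) := by
      have h2 : Fintype.card V * 2 ≤ (m + 2) * (m + 1) := by
        rw [Nat.choose_two_right] at hchoose
        exact (Nat.le_div_iff_mul_le two_pos).1 hchoose
      rw [mul_comm]
      exact_mod_cast h2
    by_contra! hlow
    have h3 : (m : ℝ) < t - 2 := by
      refine lt_of_mul_lt_mul_right (a := t + 1) ?_ ht1.le
      nlinarith
    have h4 : (0 : ℝ) ≤ m := Nat.cast_nonneg m
    nlinarith
  · have hm : m ≠ 1 := by
      intro hm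
      rw [hm] at hchoose
      have h1 : (Fintype.card V : ℝ) ≤ 3 := by exact_mod_cast hchoose
      linarith
    have hint := h.exists_int_eq hs ht1 hst (by rw [hspec]; simp) hm
    have hdeg_eq {u w : V} (huw : α u = α w) : Γ.degree u = Γ.degree w := by
      have : (Γ.degree u : ℝ) = Γ.degree w := by rw [h.degree_eq, h.degree_eq, huw]
      exact_mod_cast this
    obtain ⟨w, x, hwx, hxv⟩ : ∃ w x, α w < α x ∧ α x < α v := by
      obtain ⟨x, hx⟩ : ∃ x, Γ.degree x ≠ Γ.degree v := by
        by_contra! hreg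
        exact hnonreg ⟨_, hreg⟩
      obtain ⟨y, hyx, hyv⟩ : ∃ y, Γ.degree y ≠ Γ.degree x ∧ Γ.degree y ≠ Γ.degree v := by
        by_contra! hall
        refine hnotbireg ?_
        rw [← Finset.card_pair hx]
        congr 1
        ext d
        simp only [Finset.mem_image, Finset.mem_univ, true_and, Finset.mem_insert,
          Finset.mem_singleton]
        constructor
        · rintro ⟨y, rfl⟩
          exact or_iff_not_imp_left.2 (hall y)
        · rintro (rfl | rfl)
          exacts [⟨x, rfl⟩, ⟨v, rfl⟩]
      have hxv := lt_of_le_of_ne (hv x) fun h1 => hx (hdeg_eq h1)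
      have hyv := lt_of_le_of_ne (hv y) fun h1 => hyv (hdeg_eq h1)
      rcases lt_or_gt_of_ne fun h1 => hyx (hdeg_eq h1) with h1 | h1
      · exact ⟨y, x, h1, hxv⟩
      · exact ⟨x, y, h1, hyv⟩
    have hmain : (Fintype.card V : ℝ) < t ^ 2 + 8 * t + 18 := by
      rcases le_or_gt (α v) (t + 1) with hvt | hvt
      · have h1 := h.one_le hint w
        have h2 := h.one_le_sub hint hwx
        have h3 := h.one_le_sub hint hxv
        exact h.card_lt_of_le_add_one hint ht2 hst hv (by linarith) hvt
      · refine h.card_lt_of_add_one_lt hint ht2 (fun u => ?_) hv hvt hwx hxv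
        by_contra! hall
        have h1 : Γ.degree u = Fintype.card V - 1 := by
          rw [← Γ.card_neighborFinset_eq_degree, ← Finset.card_univ,
            ← Finset.card_erase_of_mem (Finset.mem_univ u)]
          congr 1
          ext x
          simp only [SimpleGraph.mem_neighborFinset, Finset.mem_erase, Finset.mem_univ, and_true]
          exact ⟨fun hadj => hadj.ne', fun hx => hall x hx.symm⟩
        exact hnotcone ⟨u, h1⟩
    have : 0 < 18 / (t - 1) := div_pos (by norm_num) (by linarith)
    linarith
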